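/- For every δ ∈ (0,1] there exists τ₀ > 0 such that for all τ, ν with 0 < ν ≤ τ ≤ τ₀ there exists n₀ ∈ ℕ such that the following holds for every even n ≥ n₀, with ℓ := ⌈(log n)²⌉ + 1: let G be a robust (ν,τ)-expander on n vertices in which every vertex has degree exactly δn, let N be a matching in G, and let k be an integer with 1 ≤ k ≤ min{|N|, n^{1/3}}. Then for every perfect matching M of G containing exactly k edges of N, the number of perfect matchings M' of G containing exactly k−1 edges of N such that the symmetric difference M △ M' is a cycle of length 2ℓ whose edge set meets N in exactly one edge is between (1 − 3n^{−1/6})·k·δ^ℓ·n^{ℓ−1} and (1 + 3n^{−1/6})·k·δ^ℓ·n^{ℓ−1}. -/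

import Mathlib

open Finset

namespace RPM

/-- The `ν`-robust neighbourhood of a vertex set `S` in a graph `G` on `n` vertices:
all vertices having at least `ν * n` neighbours in `S`. -/
def RN {V : Type*} [Fintype V] (G : SimpleGraph V) (ν : ℝ) (S : Set V) : Set V :=
  {v : V | ν * (Fintype.card V : ℝ) ≤ (Nat.card {u : V | u ∈ S ∧ G.Adj v u} : ℝ)}

/-- `G` is a robust `(ν, τ)`-expander. -/
def RobustExpander {V : Type*} [Fintype V] (G : SimpleGraph V) (ν τ : ℝ) : Prop :=
  ∀ S : Set V,
    τ * (Fintype.card V : ℝ) ≤ (Nat.card S : ℝ) →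
    (Nat.card S : ℝ) ≤ (1 - τ) * (Fintype.card V : ℝ) →
    (Nat.card S : ℝ) + ν * (Fintype.card V : ℝ) ≤ (Nat.card (RN G ν S) : ℝ)

/-- `M` (a set of edges) is a perfect matching of `G`: its edges are edges of `G`,
and every vertex lies in exactly one edge of `M` (in particular the edges are
pairwise disjoint and cover all vertices). -/
def IsPM {V : Type*} (G : SimpleGraph V) (M : Finset (Sym2 V)) : Prop :=
  (∀ e ∈ M, e ∈ G.edgeSet) ∧ ∀ v : V, ∃! e, e ∈ M ∧ v ∈ e

/-- The number of perfect matchings of `G`. -/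
noncomputable def pmCount {V : Type*} (G : SimpleGraph V) : ℕ :=
  Nat.card {M : Finset (Sym2 V) // IsPM G M}

/-- `N` (a set of edges) is a matching in `G`: edges of `G`, pairwise disjoint. -/
def IsMatchingIn {V : Type*} (G : SimpleGraph V) (N : Finset (Sym2 V)) : Prop :=
  (∀ e ∈ N, e ∈ G.edgeSet) ∧ ∀ e ∈ N, ∀ f ∈ N, e ≠ f → ∀ v : V, v ∈ e → v ∉ f

/-- `G` is `d`-regular: every vertex has exactly `d` neighbours. -/
def RegularDeg {V : Type*} (G : SimpleGraph V) (d : ℕ) : Prop :=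
  ∀ v : V, Nat.card {u : V | G.Adj v u} = d

/-- Probability that a uniformly random perfect matching of `G` contains the edge `e`. -/
noncomputable def edgeProb {V : Type*} (G : SimpleGraph V) (e : Sym2 V) : ℝ :=
  (Nat.card {M : Finset (Sym2 V) // IsPM G M ∧ e ∈ M} : ℝ) / (pmCount G : ℝ)

/-- `P[X = k]` where `X = |M ∩ N|` for a uniformly random perfect matching `M` of `G`. -/
noncomputable def interProb {V : Type*} [DecidableEq V] (G : SimpleGraph V)
    (N : Finset (Sym2 V)) (k : ℕ) : ℝ :=
  (Nat.card {M : Finset (Sym2 V) // IsPM G M ∧ (M ∩ N).card = k} : ℝ) / (pmCount G : ℝ)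

/-- The Poisson probability mass function with parameter `lam`. -/
noncomputable def poissonPMF (lam : ℝ) (k : ℕ) : ℝ :=
  Real.exp (-lam) * lam ^ k / (Nat.factorial k)

/-- The edge set `E` forms a cycle of length `m`: there is an injective cyclic sequence
of `m` vertices whose `m` consecutive (distinct) pairs are exactly the edges of `E`. -/
def IsCycleEdgeSet {V : Type*} [DecidableEq V] (E : Finset (Sym2 V)) (m : ℕ) : Prop :=
  ∃ c : Fin m → V, Function.Injective c ∧
    E = Finset.image (fun i : Fin m => s(c i, c (finRotate m i))) Finset.univ ∧ E.card = m

/-! ### Mixing for doubly regular nonnegative matrices -/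

section Mixing

variable {V : Type*} [Fintype V]

theorem sum_row_pow [DecidableEq V] {B : Matrix V V ℝ} {d : ℝ} (hrow : ∀ u, ∑ v, B u v = d)
    (i : ℕ) (u : V) :
    ∑ v, (B ^ i) u v = d ^ i := by
  induction i generalizing u with
  | zero => simp [Matrix.one_apply]
  | succ i ih =>
    simp only [pow_succ', Matrix.mul_apply]
    rw [sum_comm]
    simp only [← mul_sum, ih]
    rw [← sum_mul, hrow]

theorem sum_col_pow [DecidableEq V] {B : Matrix V V ℝ} {d : ℝ} (hcol : ∀ v, ∑ u, B u v = d)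
    (i : ℕ) (v : V) :
    ∑ u, (B ^ i) u v = d ^ i := by
  induction i generalizing v with
  | zero => simp [Matrix.one_apply]
  | succ i ih =>
    simp only [pow_succ, Matrix.mul_apply]
    rw [sum_comm]
    simp only [← sum_mul, ih]
    rw [← mul_sum, hcol]

/-- Left multiplication by a matrix with entries at least `s` and row sums `D` contracts the
oscillation of every column by the factor `D - s * |V|`. -/
theorem column_oscillation_mul {P A : Matrix V V ℝ} {s D ρ : ℝ} {v : V}
    (hs : ∀ u w, s ≤ P u w) (hD : ∀ u, ∑ w, P u w = D)
    (hA : ∃ a, ∀ u, a ≤ A u v ∧ A u v ≤ a + ρ) :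
    ∃ a, ∀ u, a ≤ (P * A) u v ∧ (P * A) u v ≤ a + (D - s * Fintype.card V) * ρ := by
  obtain ⟨a, ha⟩ := hA
  refine ⟨D * a + s * ∑ w, (A w v - a), fun u => ?_⟩
  have key : (P * A) u v = D * a + s * ∑ w, (A w v - a) + ∑ w, (P u w - s) * (A w v - a) := by
    rw [Matrix.mul_apply, mul_sum, add_assoc, ← sum_add_distrib, ← hD u, sum_mul,
      ← sum_add_distrib]
    exact sum_congr rfl fun w _ => by ring
  have hsum : (D - s * Fintype.card V) * ρ = ∑ w, (P u w - s) * ρ := by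
    rw [← sum_mul, sum_sub_distrib, hD u]
    simp [mul_comm]
  rw [key, hsum]
  constructor
  · have : 0 ≤ ∑ w, (P u w - s) * (A w v - a) :=
      sum_nonneg fun w _ => mul_nonneg (by linarith [hs u w]) (by linarith [(ha w).1])
    linarith
  · gcongr with w
    · linarith [hs u w]
    · linarith [(ha w).2]

theorem abs_pow_apply_sub_le [DecidableEq V] [Nonempty V] {B : Matrix V V ℝ} {d s : ℝ} {m : ℕ}
    (h0 : ∀ u v, 0 ≤ B u v) (hrow : ∀ u, ∑ v, B u v = d) (hcol : ∀ v, ∑ u, B u v = d)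
    (hs : ∀ u v, s ≤ (B ^ m) u v) (q r : ℕ) (u v : V) :
    |(B ^ (m * q + r)) u v - d ^ (m * q + r) / Fintype.card V| ≤
      (d ^ m - s * Fintype.card V) ^ q * d ^ r := by
  have hr : ∃ a, ∀ u, a ≤ (B ^ r) u v ∧ (B ^ r) u v ≤ a + d ^ r := by
    induction r with
    | zero =>
      refine ⟨0, fun u => ?_⟩
      by_cases h : u = v <;> simp [h]
    | succ r ih =>
      have := column_oscillation_mul h0 hrow ih
      rw [zero_mul, sub_zero] at this
      rw [pow_succ' B, pow_succ' d]
      exact this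
  have hq : ∃ a, ∀ u, a ≤ (B ^ (m * q + r)) u v ∧
      (B ^ (m * q + r)) u v ≤ a + (d ^ m - s * Fintype.card V) ^ q * d ^ r := by
    induction q with
    | zero => simpa using hr
    | succ q ih =>
      have := column_oscillation_mul hs (sum_row_pow hrow m) ih
      rw [← pow_add] at this
      rw [show m * (q + 1) + r = m + (m * q + r) by ring, pow_succ' (_ - _), mul_assoc]
      exact this
  obtain ⟨a, ha⟩ := hq
  have hn : (0 : ℝ) < Fintype.card V := by exact_mod_cast Fintype.card_pos
  have hc := sum_col_pow hcol (m * q + r) v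
  have h1 : Fintype.card V * a ≤ d ^ (m * q + r) := by
    rw [← hc, ← nsmul_eq_mul]
    exact card_nsmul_le_sum _ _ _ fun w _ => (ha w).1
  have h2 : d ^ (m * q + r) ≤
      Fintype.card V * (a + (d ^ m - s * Fintype.card V) ^ q * d ^ r) := by
    rw [← hc, ← nsmul_eq_mul]
    exact sum_le_card_nsmul _ _ _ fun w _ => (ha w).2
  have h3 : a ≤ d ^ (m * q + r) / Fintype.card V := by rwa [le_div_iff₀' hn]
  have h4 : d ^ (m * q + r) / Fintype.card V ≤
      a + (d ^ m - s * Fintype.card V) ^ q * d ^ r := by rwa [div_le_iff₀' hn]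
  rw [abs_le]
  constructor <;> linarith [(ha u).1, (ha u).2]

end Mixing

/-! ### Walks along a relation -/

section Walks

variable {V : Type*} [Fintype V]

open Classical in
/-- Walks with `j` steps along `R` starting at `y`, extended by the constant value `y`. -/
noncomputable def walks (R : V → V → Prop) (y : V) : ℕ → Finset (ℕ → V)
  | 0 => {fun _ => y}
  | j + 1 => ((walks R y j).sigma fun z => univ.filter (R (z j))).image
      fun x => Function.update x.1 (j + 1) x.2

theorem mem_walks {R : V → V → Prop} {y : V} {j : ℕ} {z : ℕ → V} :
    z ∈ walks R y j ↔ z 0 = y ∧ (∀ i < j, R (z i) (z (i + 1))) ∧ ∀ i, j < i → z i = y := by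
  induction j generalizing z with
  | zero =>
    simp only [walks, mem_singleton, not_lt_zero, false_imp_iff, implies_true, true_and]
    constructor
    · rintro rfl; simp
    · rintro ⟨h0, h1⟩
      ext i
      rcases Nat.eq_zero_or_pos i with rfl | hi
      · exact h0
      · exact h1 i hi
  | succ j ih =>
    simp only [walks, mem_image, mem_sigma, mem_filter, mem_univ, true_and, Sigma.exists, ih]
    constructor
    · rintro ⟨x, v, ⟨⟨h0, h1, h2⟩, h3⟩, rfl⟩
      refine ⟨by simp [h0], fun i hi => ?_, fun i hi => ?_⟩
      · rcases Nat.lt_succ_iff_lt_or_eq.1 hi with hi | rfl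
        · rw [Function.update_of_ne (by omega), Function.update_of_ne (by omega)]
          exact h1 i hi
        · rw [Function.update_of_ne (by omega), Function.update_self]
          exact h3
      · rw [Function.update_of_ne (by omega)]
        exact h2 i (by omega)
    · rintro ⟨h0, h1, h2⟩
      refine ⟨Function.update z (j + 1) y, z (j + 1),
        ⟨⟨?_, fun i hi => ?_, fun i hi => ?_⟩, ?_⟩, ?_⟩
      · simpa using h0
      · rw [Function.update_of_ne (by omega), Function.update_of_ne (by omega)]
        exact h1 i (by omega)
      · rcases eq_or_ne i (j + 1) with rfl | hne
        · simp
        · rw [Function.update_of_ne hne]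
          exact h2 i (by omega)
      · rw [Function.update_of_ne (by omega)]
        exact h1 j (by omega)
      · simp

open Classical in
theorem sum_walks_succ {R : V → V → Prop} {y : V} {j : ℕ} {α : Type*} [AddCommMonoid α]
    (f : (ℕ → V) → α) :
    ∑ z ∈ walks R y (j + 1), f z =
      ∑ z ∈ walks R y j, ∑ v with R (z j) v, f (Function.update z (j + 1) v) := by
  rw [walks, sum_image, sum_sigma]
  rintro ⟨z, v⟩ hz ⟨z', v'⟩ hz' h
  simp only [coe_sigma, Set.mem_sigma_iff, mem_coe, mem_walks] at hz hz'
  dsimp only at h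
  have hv : v = v' := by simpa using congrFun h (j + 1)
  subst hv
  have hzz : z = z' := by
    ext i
    rcases eq_or_ne i (j + 1) with rfl | hne
    · rw [hz.1.2.2 _ (by omega), hz'.1.2.2 _ (by omega)]
    · simpa [Function.update_of_ne hne] using congrFun h i
  rw [hzz]

open Classical in
theorem card_walks_le {R : V → V → Prop} {d : ℕ} (hR : ∀ u, #{v | R u v} ≤ d) (y : V) (j : ℕ) :
    #(walks R y j) ≤ d ^ j := by
  induction j with
  | zero => simp [walks]
  | succ j ih =>
    rw [card_eq_sum_ones, sum_walks_succ]
    calc _ ≤ ∑ z ∈ walks R y j, d := sum_le_sum fun z _ => by simpa using hR (z j)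
      _ ≤ d ^ (j + 1) := by
        rw [sum_const, smul_eq_mul, pow_succ]
        gcongr

open Classical in
theorem card_walks_to [DecidableEq V] {R : V → V → Prop} (y v : V) (j : ℕ) :
    (#{z ∈ walks R y j | z j = v} : ℝ) =
      ((Matrix.of fun u w => if R u w then (1 : ℝ) else 0) ^ j) y v := by
  induction j generalizing v with
  | zero =>
    simp only [walks, filter_singleton, pow_zero, Matrix.one_apply]
    split_ifs <;> simp
  | succ j ih =>
    rw [pow_succ, Matrix.mul_apply, card_filter, Nat.cast_sum, sum_walks_succ]
    simp only [← ih, card_filter, Nat.cast_sum, sum_mul]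
    rw [sum_comm]
    refine sum_congr rfl fun z _ => ?_
    simp [Finset.sum_ite]

open Classical in
/-- The number of walks which at some step enter a set of at most `K` forbidden vertices depending
only on the past. -/
theorem card_forbidden_walks_le [DecidableEq V] {R : V → V → Prop} {d K : ℕ}
    (hR : ∀ u, #{v | R u v} ≤ d) (y : V) (F : ℕ → (ℕ → V) → Finset V)
    (hF : ∀ j z z', (∀ i ≤ j, z i = z' i) → F j z = F j z') (L : ℕ)
    (hK : ∀ j < L, ∀ z, #(F j z) ≤ K) :
    #{z ∈ walks R y L | ∃ j < L, z (j + 1) ∈ F j z} ≤ L * K * d ^ (L - 1) := by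
  induction L with
  | zero => simp
  | succ L ih =>
    specialize ih fun j hj => hK j (by omega)
    have hstep : ∀ z ∈ walks R y L, (∑ v with R (z L) v,
        if ∃ j < L + 1, Function.update z (L + 1) v (j + 1) ∈ F j (Function.update z (L + 1) v)
        then 1 else 0) ≤ d * (if ∃ j < L, z (j + 1) ∈ F j z then 1 else 0) + K := by
      intro z _
      have hloc : ∀ j ≤ L, ∀ v, F j (Function.update z (L + 1) v) = F j z := fun j hj v =>
        hF _ _ _ fun i hi => Function.update_of_ne (by omega) _ _
      split_ifs with h
      · calc _ ≤ ∑ v with R (z L) v, 1 := sum_le_sum fun v _ => by split_ifs <;> simp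
          _ ≤ _ := by have := hR (z L); simp; omega
      · calc _ ≤ ∑ v with R (z L) v, (if v ∈ F L z then 1 else 0) := by
              refine sum_le_sum fun v _ => ?_
              split_ifs with h1 h2 <;> try simp
              obtain ⟨j, hj, hj'⟩ := h1
              rw [hloc j (by omega)] at hj'
              rcases Nat.lt_succ_iff_lt_or_eq.1 hj with hj | rfl
              · rw [Function.update_of_ne (by omega)] at hj'
                exact h ⟨j, hj, hj'⟩
              · rw [Function.update_self] at hj'
                exact h2 hj'
          _ ≤ ∑ v, (if v ∈ F L z then 1 else 0) :=
              sum_le_sum_of_subset (filter_subset _ _)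
          _ ≤ _ := by simpa using hK L (by omega) z
    rw [card_filter, sum_walks_succ]
    calc _ ≤ ∑ z ∈ walks R y L, (d * (if ∃ j < L, z (j + 1) ∈ F j z then 1 else 0) + K) :=
          sum_le_sum hstep
      _ = d * #{z ∈ walks R y L | ∃ j < L, z (j + 1) ∈ F j z} + #(walks R y L) * K := by
          rw [sum_add_distrib, ← mul_sum, ← card_filter]; simp
      _ ≤ d * (L * K * d ^ (L - 1)) + d ^ L * K := by
          gcongr
          exact card_walks_le hR y L
      _ = (L + 1) * K * d ^ (L + 1 - 1) := by
          rcases L with _ | L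
          · simp
          · simp only [Nat.add_sub_cancel, pow_succ]; ring

end Walks

/-! ### Mixing of the alternating walk in a robust expander -/

section Expander

variable {V : Type*}

open Classical in
/-- The transition matrix of the walk which follows an edge of `G` and then applies the
involution `p`. -/
noncomputable def stepMatrix (G : SimpleGraph V) (p : V → V) : Matrix V V ℝ :=
  Matrix.of fun u w => if G.Adj u (p w) then 1 else 0

theorem stepMatrix_nonneg (G : SimpleGraph V) (p : V → V) (u v : V) : 0 ≤ stepMatrix G p u v := by
  simp only [stepMatrix, Matrix.of_apply]
  split_ifs <;> simp

theorem card_adj_involution (G : SimpleGraph V) {p : V → V} (hp : ∀ v, p (p v) = v) (S : Set V)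
    (u : V) : Nat.card {w : V | w ∈ S ∧ G.Adj u (p w)} =
      Nat.card {x : V | x ∈ p ⁻¹' S ∧ G.Adj u x} :=
  Nat.card_congr
    { toFun := fun w => ⟨p w, by rw [Set.mem_preimage, hp]; exact w.2.1, w.2.2⟩
      invFun := fun x => ⟨p x, x.2.1, by rw [hp]; exact x.2.2⟩
      left_inv := fun w => Subtype.ext (hp w)
      right_inv := fun x => Subtype.ext (hp x) }

variable [Fintype V]

open Classical in
theorem card_filter_adj_involution (G : SimpleGraph V) {p : V → V} (hp : ∀ v, p (p v) = v)
    (u : V) : #{w | G.Adj u (p w)} = Nat.card {x : V | G.Adj u x} := by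
  have := card_adj_involution G hp Set.univ u
  simp only [Set.mem_univ, true_and, Set.preimage_univ] at this
  rw [← this, Nat.card_eq_fintype_card, Fintype.card_subtype]
  rfl

theorem sum_stepMatrix_row {G : SimpleGraph V} {p : V → V} (hp : ∀ v, p (p v) = v) {d : ℝ}
    (hd : ∀ v, (Nat.card {u : V | G.Adj v u} : ℝ) = d) (u : V) :
    ∑ v, stepMatrix G p u v = d := by
  simp [stepMatrix, ← hd u, ← card_filter_adj_involution G hp u]

theorem sum_stepMatrix_col {G : SimpleGraph V} {p : V → V} {d : ℝ}
    (hd : ∀ v, (Nat.card {u : V | G.Adj v u} : ℝ) = d) (v : V) :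
    ∑ u, stepMatrix G p u v = d := by
  classical
  rw [← hd (p v), Nat.card_eq_fintype_card, Fintype.card_subtype]
  simp [stepMatrix, G.adj_comm (p v)]

theorem le_stepMatrix_mul {G : SimpleGraph V} {p : V → V} (hp : ∀ v, p (p v) = v)
    {A : Matrix V V ℝ} {v u : V} {S : Set V} {t ν : ℝ} (ht : 0 ≤ t) (hA : ∀ w, 0 ≤ A w v)
    (hS : ∀ w ∈ S, t ≤ A w v) (hu : u ∈ RN G ν (p ⁻¹' S)) :
    ν * Fintype.card V * t ≤ (stepMatrix G p * A) u v := by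
  classical
  have hu' : ν * Fintype.card V ≤ (Nat.card {x : V | x ∈ p ⁻¹' S ∧ G.Adj u x} : ℝ) := hu
  rw [← card_adj_involution G hp, Nat.card_eq_fintype_card, Fintype.card_subtype] at hu'
  calc ν * Fintype.card V * t ≤ (#{w | w ∈ S ∧ G.Adj u (p w)} : ℝ) * t := by
        gcongr
        refine le_of_le_of_eq hu' ?_
        congr
    _ = ∑ w with w ∈ S ∧ G.Adj u (p w), t := by rw [sum_const, nsmul_eq_mul]
    _ ≤ ∑ w with w ∈ S ∧ G.Adj u (p w), stepMatrix G p u w * A w v := by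
        refine sum_le_sum fun w hw => ?_
        rw [mem_filter] at hw
        simpa [stepMatrix, hw.2.2] using hS w hw.2.1
    _ ≤ (stepMatrix G p * A) u v := by
        rw [Matrix.mul_apply]
        exact sum_le_sum_of_subset_of_nonneg (filter_subset _ _) fun w _ _ =>
          mul_nonneg (stepMatrix_nonneg G p u w) (hA w)

theorem RN_eq_univ {G : SimpleGraph V} {δ τ ν : ℝ}
    (hdeg : ∀ v, (Nat.card {u : V | G.Adj v u} : ℝ) = δ * Fintype.card V)
    (hντ : ν ≤ τ) (hτδ : 2 * τ ≤ δ) {S : Set V}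
    (hS : (1 - τ) * Fintype.card V < Nat.card S) : RN G ν S = Set.univ := by
  classical
  refine Set.eq_univ_of_forall fun v => ?_
  have h1 : Nat.card {u : V | G.Adj v u} ≤
      Nat.card {u : V | u ∈ S ∧ G.Adj v u} + Nat.card ↑Sᶜ := by
    simp only [Nat.card_coe_set_eq]
    refine (Set.ncard_le_ncard ?_ (Set.toFinite _)).trans (Set.ncard_union_le _ _)
    intro u hu
    by_cases h : u ∈ S
    · exact Or.inl ⟨h, hu⟩
    · exact Or.inr h
  have h2 : Nat.card S + Nat.card ↑Sᶜ = Fintype.card V := by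
    simp only [Nat.card_coe_set_eq]
    rw [Set.ncard_add_ncard_compl, Nat.card_eq_fintype_card]
  have h1' : δ * Fintype.card V ≤
      (Nat.card {u : V | u ∈ S ∧ G.Adj v u} : ℝ) + Nat.card ↑Sᶜ := by
    rw [← hdeg v]; exact_mod_cast h1
  have h2' : (Nat.card S : ℝ) + Nat.card ↑Sᶜ = Fintype.card V := by exact_mod_cast h2
  have h3 : (0 : ℝ) ≤ (δ - τ - ν) * Fintype.card V := mul_nonneg (by linarith) (by positivity)
  change ν * (Fintype.card V : ℝ) ≤ (Nat.card {u : V | u ∈ S ∧ G.Adj v u} : ℝ)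
  linarith

theorem stepMatrix_pow_nonneg [DecidableEq V] (G : SimpleGraph V) (p : V → V) (i : ℕ) (u v : V) :
    0 ≤ (stepMatrix G p ^ i) u v := by
  induction i generalizing u with
  | zero => rw [pow_zero, Matrix.one_apply]; split_ifs <;> simp
  | succ i ih =>
    rw [pow_succ', Matrix.mul_apply]
    exact sum_nonneg fun w _ => mul_nonneg (stepMatrix_nonneg G p u w) (ih w)

/-- After boundedly many steps the walk has a positive density of ways to reach each vertex. -/
theorem le_stepMatrix_pow [DecidableEq V] {G : SimpleGraph V} {p : V → V}
    (hp : ∀ v, p (p v) = v) {δ τ ν : ℝ}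
    (hdeg : ∀ v, (Nat.card {u : V | G.Adj v u} : ℝ) = δ * Fintype.card V)
    (hG : RobustExpander G ν τ) (hν : 0 < ν) (hντ : ν ≤ τ) (hτδ : 2 * τ ≤ δ)
    (u v : V) :
    (ν * Fintype.card V) ^ (⌈1 / ν⌉₊ + 1) ≤ (stepMatrix G p ^ (⌈1 / ν⌉₊ + 2)) u v := by
  classical
  have hn : (0 : ℝ) < Fintype.card V := by exact_mod_cast Fintype.card_pos_iff.2 ⟨u⟩
  have hcard : ∀ S : Set V, Nat.card (p ⁻¹' S) = Nat.card S := fun S =>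
    Nat.card_preimage_of_injective (Function.LeftInverse.injective hp)
      fun x _ => ⟨p x, hp x⟩
  have key : ∀ j : ℕ, ∃ S : Set V,
      (∀ w ∈ S, (ν * Fintype.card V) ^ j ≤ (stepMatrix G p ^ (j + 1)) w v) ∧
      ((δ + j * ν) * Fintype.card V ≤ Nat.card S ∨ (1 - τ) * Fintype.card V < Nat.card S) := by
    intro j
    induction j with
    | zero =>
      refine ⟨{w | G.Adj (p v) w}, fun w hw => ?_, Or.inl ?_⟩
      · have : G.Adj w (p v) := hw.symm
        simp [stepMatrix, this]
      · simp [← hdeg (p v)]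
    | succ j ih =>
      obtain ⟨S, hS, hsize⟩ := ih
      refine ⟨RN G ν (p ⁻¹' S), fun w hw => ?_, ?_⟩
      · rw [pow_succ' (ν * _), pow_succ' (stepMatrix G p)]
        exact le_stepMatrix_mul hp (by positivity) (fun w => stepMatrix_pow_nonneg G p _ w v) hS hw
      · by_cases h : (1 - τ) * Fintype.card V < Nat.card S
        · right
          rw [RN_eq_univ hdeg hντ hτδ (by rwa [hcard])]
          rw [Nat.card_univ, Nat.card_eq_fintype_card]
          nlinarith
        · left
          have h1 := hsize.resolve_right h
          have h2 := hG (p ⁻¹' S) (by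
            rw [hcard]
            refine le_trans ?_ h1
            gcongr
            have : 0 ≤ (j : ℝ) * ν := by positivity
            linarith) (by rw [hcard]; exact not_lt.1 h)
          rw [hcard] at h2
          push_cast
          linarith
  obtain ⟨S, hS, hsize⟩ := key ⌈1 / ν⌉₊
  have hbig : (1 - τ) * Fintype.card V < Nat.card S := by
    refine hsize.resolve_left fun h => ?_
    have h1 : (1 : ℝ) ≤ ⌈1 / ν⌉₊ * ν := by
      rw [← div_le_iff₀ hν]; exact Nat.le_ceil _
    have h2 : (Nat.card S : ℝ) ≤ Fintype.card V := by
      rw [← Nat.card_eq_fintype_card]; exact_mod_cast Finite.card_subtype_le _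
    nlinarith
  have hu : u ∈ RN G ν (p ⁻¹' S) := by
    rw [RN_eq_univ hdeg hντ hτδ (by rwa [hcard])]; trivial
  rw [pow_succ' (ν * _), pow_succ' (stepMatrix G p)]
  exact le_stepMatrix_mul hp (by positivity) (fun w => stepMatrix_pow_nonneg G p _ w v) hS hu

end Expander

/-! ### Perfect matchings as involutions -/

section Partner

variable {V : Type*} {G : SimpleGraph V} {M : Finset (Sym2 V)}

theorem IsPM.exists_partner (hM : IsPM G M) : ∃ p : V → V, (∀ v, p (p v) = v) ∧
    (∀ v, G.Adj v (p v)) ∧ ∀ u w, s(u, w) ∈ M ↔ p u = w := by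
  have h : ∀ v, ∃ w, s(v, w) ∈ M := fun v => by
    obtain ⟨e, ⟨he, hv⟩, -⟩ := hM.2 v
    obtain ⟨w, rfl⟩ := Sym2.mem_iff_exists.1 hv
    exact ⟨w, he⟩
  choose p hp using h
  have huniq : ∀ u w, s(u, w) ∈ M → p u = w := fun u w huw => by
    have := (hM.2 u).unique ⟨hp u, Sym2.mem_mk_left _ _⟩ ⟨huw, Sym2.mem_mk_left _ _⟩
    exact Sym2.congr_right.1 this
  refine ⟨p, fun v => huniq _ _ (by rw [Sym2.eq_swap]; exact hp v), fun v => hM.1 _ (hp v),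
    fun u w => ⟨huniq u w, ?_⟩⟩
  rintro rfl
  exact hp u

theorem eq_mk_partner {p : V → V} (hM : ∀ u w, s(u, w) ∈ M ↔ p u = w) {e : Sym2 V}
    (he : e ∈ M) {y : V} (hy : y ∈ e) : e = s(y, p y) := by
  obtain ⟨w, rfl⟩ := Sym2.mem_iff_exists.1 hy
  rw [(hM _ _).1 he]

end Partner

/-! ### Cycles as cyclic sequences indexed by natural numbers -/

section Cycle

variable {V : Type*} [DecidableEq V]

theorem finRotate_val {m : ℕ} (i : Fin m) :
    (finRotate m i : ℕ) = if (i : ℕ) + 1 = m then 0 else (i : ℕ) + 1 := by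
  rcases m with _ | m
  · exact i.elim0
  · split_ifs with h
    · have : i = Fin.last m := Fin.ext (by simpa using h)
      simp [this]
    · exact coe_finRotate_of_ne_last fun h' => h (by simp [h'])

theorem isCycleEdgeSet_image_range {m : ℕ} (hm : 3 ≤ m) {g : ℕ → V}
    (hg : ∀ i < m, ∀ j < m, g i = g j → i = j) (hgm : g m = g 0) :
    IsCycleEdgeSet ((range m).image fun i => s(g i, g (i + 1))) m := by
  refine ⟨fun i => g i, fun i j h => Fin.ext (hg _ i.2 _ j.2 h), ?_, ?_⟩
  · have hrot : ∀ i : Fin m, g (finRotate m i : ℕ) = g (i + 1) := fun i => by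
      rw [finRotate_val]
      split_ifs with h
      · rw [h, hgm]
      · rfl
    ext e
    simp only [mem_image, mem_range, mem_univ, true_and, hrot]
    exact ⟨fun ⟨i, hi, he⟩ => ⟨⟨i, hi⟩, he⟩, fun ⟨i, he⟩ => ⟨i, i.2, he⟩⟩
  · rw [card_image_of_injOn, card_range]
    intro i hi j hj h
    simp only [coe_range, Set.mem_Iio] at hi hj
    have hsucc : ∀ a < m, ∀ b < m, g a = g (b + 1) → a = b + 1 ∨ (b + 1 = m ∧ a = 0) := by
      intro a ha b hb hab
      rcases Nat.lt_or_ge (b + 1) m with hb' | hb'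
      · exact Or.inl (hg _ ha _ hb' hab)
      · have : b + 1 = m := by omega
        rw [this, hgm] at hab
        exact Or.inr ⟨this, hg _ ha _ (by omega) hab⟩
    rcases Sym2.eq_iff.1 h with ⟨h1, -⟩ | ⟨h1, h2⟩
    · exact hg _ hi _ hj h1
    · have := hsucc i hi j hj h1
      have := hsucc j hj i hi h2.symm
      omega

/-- A cycle can be traversed so that it ends with any prescribed oriented edge. -/
theorem IsCycleEdgeSet.exists_traversal {E : Finset (Sym2 V)} {m : ℕ} (hm : 2 ≤ m)
    (hE : IsCycleEdgeSet E m) {x y : V} (hxy : s(x, y) ∈ E) :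
    ∃ g : ℕ → V, g 0 = y ∧ g (m - 1) = x ∧ g m = y ∧ (∀ i < m, ∀ j < m, g i = g j → i = j) ∧
      E = (range m).image fun i => s(g i, g (i + 1)) := by
  obtain ⟨c, hc, hEc, -⟩ := hE
  have key : ∀ i : Fin m, ∃ g : ℕ → V, g 0 = c (finRotate m i) ∧ g (m - 1) = c i ∧
      g m = c (finRotate m i) ∧ (∀ i < m, ∀ j < m, g i = g j → i = j) ∧
      E = (range m).image fun i => s(g i, g (i + 1)) := by
    intro i
    have hpos : 0 < m := by omega
    have hrot : ∀ t : ℕ, finRotate m ⟨t % m, Nat.mod_lt _ hpos⟩ =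
        ⟨(t + 1) % m, Nat.mod_lt _ hpos⟩ := fun t => by
      apply Fin.ext
      rw [finRotate_val]
      have hlt := Nat.mod_lt t hpos
      simp only
      rw [Nat.add_mod t 1 m, Nat.mod_eq_of_lt (show 1 < m by omega)]
      split_ifs with h
      · rw [h, Nat.mod_self]
      · exact (Nat.mod_eq_of_lt (by omega)).symm
    have hi : i = ⟨(i : ℕ) % m, Nat.mod_lt _ hpos⟩ := Fin.ext (Nat.mod_eq_of_lt i.2).symm
    have hi1 : finRotate m i = ⟨((i : ℕ) + 1) % m, Nat.mod_lt _ hpos⟩ := by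
      conv_lhs => rw [hi]
      exact hrot i
    refine ⟨fun t => c ⟨(i + 1 + t) % m, Nat.mod_lt _ hpos⟩, ?_, ?_, ?_, ?_, ?_⟩
    · simp [hi1]
    · have : ((i : ℕ) + 1 + (m - 1)) % m = i := by
        rw [show (i : ℕ) + 1 + (m - 1) = i + m by omega, Nat.add_mod_right,
          Nat.mod_eq_of_lt i.2]
      simp only [this]
    · simp [hi1]
    · intro a ha b hb hab
      have := congrArg Fin.val (hc hab)
      simp only at this
      have h2 : a ≡ b [MOD m] := Nat.ModEq.add_left_cancel' _ this
      rwa [Nat.ModEq, Nat.mod_eq_of_lt ha, Nat.mod_eq_of_lt hb] at h2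
    · rw [hEc]
      ext e
      simp only [mem_image, mem_univ, true_and, mem_range]
      constructor
      · rintro ⟨j, rfl⟩
        refine ⟨(j + (m - 1 - i)) % m, Nat.mod_lt _ hpos, ?_⟩
        have h1 : ((i : ℕ) + 1 + (j + (m - 1 - i)) % m) % m = (j : ℕ) % m := by
          rw [Nat.add_mod_mod, show (i : ℕ) + 1 + (j + (m - 1 - i)) = j + m by omega,
            Nat.add_mod_right]
        have h2 : ((i : ℕ) + 1 + ((j + (m - 1 - i)) % m + 1)) % m = ((j : ℕ) + 1) % m := by
          rw [← add_assoc, Nat.add_mod, h1, ← Nat.add_mod]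
        have h3 := hrot j
        have hj : (⟨(j : ℕ) % m, Nat.mod_lt _ hpos⟩ : Fin m) = j :=
          Fin.ext (Nat.mod_eq_of_lt j.2)
        rw [hj] at h3
        simp only [h1, h2, hj, h3]
      · rintro ⟨t, -, rfl⟩
        exact ⟨⟨(i + 1 + t) % m, Nat.mod_lt _ hpos⟩, by rw [hrot]; simp only [add_assoc]⟩
  have hxy' := hxy
  rw [hEc] at hxy'
  obtain ⟨i, -, hi⟩ := mem_image.1 hxy'
  obtain ⟨g, h0, hlast, hgm, hinj, hEg⟩ := key i
  rcases Sym2.eq_iff.1 hi with ⟨h1, h2⟩ | ⟨h1, h2⟩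
  · exact ⟨g, h0.trans h2, hlast.trans h1, hgm.trans h2, hinj, hEg⟩
  · refine ⟨fun t => if t < m then g (m - 1 - t) else y, ?_, ?_, ?_, ?_, ?_⟩
    · simp only [show 0 < m by omega, if_true, Nat.sub_zero]
      exact hlast.trans h1
    · simp only [show m - 1 < m by omega, if_true, Nat.sub_self]
      exact h0.trans h2
    · simp
    · intro a ha b hb hab
      simp only [ha, hb, if_true] at hab
      have := hinj _ (by omega) _ (by omega) hab
      omega
    · rw [hEg]
      have hedge : ∀ t < m, s(if t < m then g (m - 1 - t) else y,
          if t + 1 < m then g (m - 1 - (t + 1)) else y) =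
          s(g (if t + 1 < m then m - 2 - t else m - 1),
            g ((if t + 1 < m then m - 2 - t else m - 1) + 1)) := by
        intro t ht
        rw [if_pos ht]
        by_cases h : t + 1 < m
        · simp only [if_pos h]
          rw [Sym2.eq_swap, show m - 1 - (t + 1) = m - 2 - t by omega,
            show m - 1 - t = m - 2 - t + 1 by omega]
        · simp only [if_neg h]
          rw [show m - 1 - t = 0 by omega, show m - 1 + 1 = m by omega, hgm, hlast, h1, h0,
            Sym2.eq_swap]
      ext e
      simp only [mem_image, mem_range]
      constructor
      · rintro ⟨t, ht, rfl⟩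
        refine ⟨if t + 1 < m then m - 2 - t else m - 1, by split_ifs <;> omega, ?_⟩
        rw [hedge _ (by split_ifs <;> omega)]
        have : (if (if t + 1 < m then m - 2 - t else m - 1) + 1 < m
            then m - 2 - (if t + 1 < m then m - 2 - t else m - 1) else m - 1) = t := by
          split_ifs <;> omega
        rw [this]
      · rintro ⟨t, ht, rfl⟩
        exact ⟨_, by split_ifs <;> omega, (hedge t ht).symm⟩

end Cycle

/-! ### Switching along an alternating cycle -/

section Switch

variable {V : Type*}

/-- The edges of the alternating cycle `p (z 0), z 0, p (z 1), z 1, …`. -/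
def switchEdges [DecidableEq V] (p : V → V) (ℓ : ℕ) (z : ℕ → V) : Finset (Sym2 V) :=
  ((range ℓ).image fun i => s(z (i + 1), p (z (i + 1)))) ∪
    (range ℓ).image fun i => s(z i, p (z (i + 1)))

theorem mem_switchEdges [DecidableEq V] {p : V → V} {ℓ : ℕ} {z : ℕ → V} {e : Sym2 V} :
    e ∈ switchEdges p ℓ z ↔ (∃ i < ℓ, s(z (i + 1), p (z (i + 1))) = e) ∨
      ∃ i < ℓ, s(z i, p (z (i + 1))) = e := by
  simp [switchEdges]

/-- The sequence `z` describes an alternating cycle of length `2 * ℓ`, with respect to the perfect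
matching given by `p`, whose only edge in `N` is the edge from `y` to `p y`. -/
structure IsSwitch (G : SimpleGraph V) (p : V → V) (N : Finset (Sym2 V)) (y : V) (ℓ : ℕ)
    (z : ℕ → V) : Prop where
  start : z 0 = y
  finish : z ℓ = y
  adj : ∀ i < ℓ, G.Adj (z i) (p (z (i + 1)))
  inj : ∀ i < ℓ, ∀ j < ℓ, z i = z j → i = j
  ne : ∀ i < ℓ, ∀ j < ℓ, z i ≠ p (z j)
  mem : s(y, p y) ∈ N
  notMem : ∀ i, 0 < i → i < ℓ → s(z i, p (z i)) ∉ N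
  cross : ∀ i < ℓ, s(z i, p (z (i + 1))) ∉ N

namespace IsSwitch

variable {G : SimpleGraph V} {p : V → V} {M N : Finset (Sym2 V)} {y : V} {ℓ : ℕ} {z : ℕ → V}

theorem succ_cases (h : IsSwitch G p N y ℓ z) {i : ℕ} (hi : i < ℓ) :
    i + 1 < ℓ ∨ (i + 1 = ℓ ∧ z (i + 1) = z 0) := by
  rcases Nat.lt_or_ge (i + 1) ℓ with h1 | h1
  · exact Or.inl h1
  · have : i + 1 = ℓ := by omega
    exact Or.inr ⟨this, by rw [this, h.start, h.finish]⟩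

theorem inj_succ (h : IsSwitch G p N y ℓ z) {i j : ℕ} (hi : i < ℓ) (hj : j < ℓ)
    (hij : z i = z (j + 1)) : i = j + 1 ∨ (j + 1 = ℓ ∧ i = 0) := by
  rcases h.succ_cases hj with h1 | ⟨h1, h2⟩
  · exact Or.inl (h.inj _ hi _ h1 hij)
  · exact Or.inr ⟨h1, h.inj _ hi _ (by omega) (hij.trans h2)⟩

theorem succ_inj (h : IsSwitch G p N y ℓ z) {i j : ℕ} (hi : i < ℓ) (hj : j < ℓ)
    (hij : z (i + 1) = z (j + 1)) : i = j := by
  rcases h.succ_cases hi with h1 | ⟨h1, h2⟩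
  · have := h.inj_succ h1 hj hij
    omega
  · have := h.inj_succ (by omega) hj (h2.symm.trans hij)
    omega

theorem ne_succ (h : IsSwitch G p N y ℓ z) {i j : ℕ} (hi : i < ℓ) (hj : j < ℓ) :
    z i ≠ p (z (j + 1)) := by
  rcases h.succ_cases hj with h1 | ⟨-, h2⟩
  · exact h.ne _ hi _ h1
  · rw [h2]
    exact h.ne _ hi _ (by omega)

theorem exists_succ (h : IsSwitch G p N y ℓ z) {i : ℕ} (hi : i < ℓ) :
    ∃ j < ℓ, z (j + 1) = z i := by
  rcases i with _ | i
  · exact ⟨ℓ - 1, by omega, by rw [Nat.sub_add_cancel (by omega), h.start, h.finish]⟩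
  · exact ⟨i, by omega, rfl⟩

theorem exists_eq_succ (h : IsSwitch G p N y ℓ z) {i : ℕ} (hi : i < ℓ) :
    ∃ j < ℓ, z j = z (i + 1) := by
  rcases h.succ_cases hi with h1 | ⟨-, h2⟩
  · exact ⟨i + 1, h1, rfl⟩
  · exact ⟨0, by omega, h2.symm⟩

theorem cross_notMem (h : IsSwitch G p N y ℓ z) (hℓ : 2 ≤ ℓ) (hp : ∀ v, p (p v) = v)
    (hM : ∀ u w, s(u, w) ∈ M ↔ p u = w) {i : ℕ} (hi : i < ℓ) :
    s(z i, p (z (i + 1))) ∉ M := by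
  rw [hM]
  intro h1
  have := h.inj_succ hi hi (Function.LeftInverse.injective hp h1)
  omega

variable [DecidableEq V]

theorem mem_symmDiff (h : IsSwitch G p N y ℓ z) (hℓ : 2 ≤ ℓ) (hp : ∀ v, p (p v) = v)
    (hM : ∀ u w, s(u, w) ∈ M ↔ p u = w) {e : Sym2 V} :
    e ∈ symmDiff M (switchEdges p ℓ z) ↔
      (e ∈ M ∧ ∀ i < ℓ, s(z (i + 1), p (z (i + 1))) ≠ e) ∨
        ∃ i < ℓ, s(z i, p (z (i + 1))) = e := by
  rw [Finset.mem_symmDiff, mem_switchEdges]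
  have hc : ∀ i < ℓ, s(z i, p (z (i + 1))) = e → e ∉ M := by
    rintro i hi rfl
    exact h.cross_notMem hℓ hp hM hi
  have hm : ∀ i < ℓ, s(z (i + 1), p (z (i + 1))) = e → e ∈ M := by
    rintro i hi rfl
    exact (hM _ _).2 rfl
  constructor
  · rintro (⟨h1, h2⟩ | ⟨h1, h2⟩)
    · exact Or.inl ⟨h1, fun i hi he => h2 (Or.inl ⟨i, hi, he⟩)⟩
    · rcases h1 with ⟨i, hi, he⟩ | h1
      · exact absurd (hm i hi he) h2
      · exact Or.inr h1
  · rintro (⟨h1, h2⟩ | ⟨i, hi, he⟩)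
    · refine Or.inl ⟨h1, ?_⟩
      rintro (⟨i, hi, he⟩ | ⟨i, hi, he⟩)
      · exact h2 i hi he
      · exact hc i hi he h1
    · exact Or.inr ⟨Or.inr ⟨i, hi, he⟩, hc i hi he⟩

theorem isPM (h : IsSwitch G p N y ℓ z) (hℓ : 2 ≤ ℓ) (hp : ∀ v, p (p v) = v)
    (hadj : ∀ v, G.Adj v (p v)) (hM : ∀ u w, s(u, w) ∈ M ↔ p u = w) :
    IsPM G (symmDiff M (switchEdges p ℓ z)) := by
  have hmem : ∀ {e v}, e ∈ M → v ∈ e → e = s(v, p v) := by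
    intro e v he hv
    obtain ⟨w, rfl⟩ := Sym2.mem_iff_exists.1 hv
    rw [(hM _ _).1 he]
  simp only [IsPM, h.mem_symmDiff hℓ hp hM]
  constructor
  · rintro e (⟨h1, -⟩ | ⟨i, hi, rfl⟩)
    · induction e with
      | _ u w => rw [← (hM u w).1 h1]; exact hadj u
    · exact h.adj i hi
  · intro v
    by_cases h1 : ∃ i < ℓ, z i = v
    · obtain ⟨i, hi, rfl⟩ := h1
      refine ⟨s(z i, p (z (i + 1))), ⟨Or.inr ⟨i, hi, rfl⟩, Sym2.mem_mk_left _ _⟩, ?_⟩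
      rintro e ⟨⟨he, hne⟩ | ⟨j, hj, rfl⟩, hv⟩
      · obtain ⟨j, hj, hji⟩ := h.exists_succ hi
        exact absurd (by rw [hmem he hv, hji]) (hne j hj)
      · rcases Sym2.mem_iff.1 hv with h2 | h2
        · rw [h.inj _ hi _ hj h2]
        · exact absurd h2 (h.ne_succ hi hj)
    by_cases h2 : ∃ i < ℓ, p (z (i + 1)) = v
    · obtain ⟨i, hi, rfl⟩ := h2
      refine ⟨s(z i, p (z (i + 1))), ⟨Or.inr ⟨i, hi, rfl⟩, Sym2.mem_mk_right _ _⟩, ?_⟩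
      rintro e ⟨⟨he, hne⟩ | ⟨j, hj, rfl⟩, hv⟩
      · exact absurd (by rw [hmem he hv, hp, Sym2.eq_swap]) (hne i hi)
      · rcases Sym2.mem_iff.1 hv with h2 | h2
        · exact absurd h2.symm (h.ne_succ hj hi)
        · rw [h.succ_inj hi hj (Function.LeftInverse.injective hp h2)]
    refine ⟨s(v, p v), ⟨Or.inl ⟨(hM _ _).2 rfl, fun i hi he => ?_⟩, Sym2.mem_mk_left _ _⟩, ?_⟩
    · rcases Sym2.eq_iff.1 he with ⟨h3, -⟩ | ⟨-, h3⟩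
      · obtain ⟨j, hj, hji⟩ := h.exists_eq_succ hi
        exact h1 ⟨j, hj, hji.trans h3⟩
      · exact h2 ⟨i, hi, h3⟩
    · rintro e ⟨⟨he, -⟩ | ⟨j, hj, rfl⟩, hv⟩
      · exact hmem he hv
      · rcases Sym2.mem_iff.1 hv with h3 | h3
        · exact absurd ⟨j, hj, h3.symm⟩ h1
        · exact absurd ⟨j, hj, h3.symm⟩ h2

theorem isCycleEdgeSet (h : IsSwitch G p N y ℓ z) (hℓ : 2 ≤ ℓ) (hp : ∀ v, p (p v) = v) :
    IsCycleEdgeSet (switchEdges p ℓ z) (2 * ℓ) := by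
  set g : ℕ → V := fun t => if t % 2 = 0 then z (t / 2) else p (z (t / 2 + 1)) with hg
  have heven : ∀ i, g (2 * i) = z i := fun i => by simp [hg]
  have hodd : ∀ i, g (2 * i + 1) = p (z (i + 1)) := fun i => by
    simp only [hg]
    rw [if_neg (by omega), show (2 * i + 1) / 2 = i by omega]
  have hpi := Function.LeftInverse.injective hp
  have hE : switchEdges p ℓ z = (range (2 * ℓ)).image fun i => s(g i, g (i + 1)) := by
    ext e
    simp only [mem_switchEdges, mem_image, mem_range]
    constructor
    · rintro (⟨i, hi, rfl⟩ | ⟨i, hi, rfl⟩)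
      · refine ⟨2 * i + 1, by omega, ?_⟩
        rw [hodd, show 2 * i + 1 + 1 = 2 * (i + 1) by ring, heven, Sym2.eq_swap]
      · exact ⟨2 * i, by omega, by rw [hodd, heven]⟩
    · rintro ⟨t, ht, rfl⟩
      rcases Nat.even_or_odd' t with ⟨i, rfl | rfl⟩
      · exact Or.inr ⟨i, by omega, by rw [hodd, heven]⟩
      · refine Or.inl ⟨i, by omega, ?_⟩
        rw [hodd, show 2 * i + 1 + 1 = 2 * (i + 1) by ring, heven, Sym2.eq_swap]
  rw [hE]
  refine isCycleEdgeSet_image_range (by omega) ?_ ?_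
  · intro a ha b hb hab
    rcases Nat.even_or_odd' a with ⟨i, rfl | rfl⟩ <;>
      rcases Nat.even_or_odd' b with ⟨j, rfl | rfl⟩
    · rw [heven, heven] at hab
      rw [h.inj i (by omega) j (by omega) hab]
    · rw [heven, hodd] at hab
      exact absurd hab (h.ne_succ (by omega) (by omega))
    · rw [heven, hodd] at hab
      exact absurd hab.symm (h.ne_succ (by omega) (by omega))
    · rw [hodd, hodd] at hab
      rw [h.succ_inj (by omega) (by omega) (hpi hab)]
  · rw [heven, h.finish, ← h.start]
    exact (heven 0).symm

theorem inter_eq (h : IsSwitch G p N y ℓ z) (hℓ : 2 ≤ ℓ) :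
    switchEdges p ℓ z ∩ N = {s(y, p y)} := by
  ext e
  rw [mem_inter, mem_switchEdges, mem_singleton]
  constructor
  · rintro ⟨⟨i, hi, rfl⟩ | ⟨i, hi, rfl⟩, he⟩
    · rcases h.succ_cases hi with h1 | ⟨-, h1⟩
      · exact absurd he (h.notMem _ (by omega) h1)
      · rw [h1, h.start]
    · exact absurd he (h.cross i hi)
  · rintro rfl
    exact ⟨Or.inl ⟨ℓ - 1, by omega, by rw [Nat.sub_add_cancel (by omega), h.finish]⟩, h.mem⟩

theorem symmDiff_inter (h : IsSwitch G p N y ℓ z) (hℓ : 2 ≤ ℓ)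
    (hM : ∀ u w, s(u, w) ∈ M ↔ p u = w) :
    symmDiff M (switchEdges p ℓ z) ∩ N = (M ∩ N).erase s(y, p y) := by
  have hy : s(y, p y) ∈ M := (hM _ _).2 rfl
  ext e
  have := Finset.ext_iff.1 (h.inter_eq hℓ) e
  simp only [mem_inter, mem_singleton] at this
  simp only [mem_inter, Finset.mem_symmDiff, mem_erase]
  by_cases he : e = s(y, p y)
  · subst he
    tauto
  · tauto

theorem ext_of_switchEdges_eq {z' : ℕ → V} (h : IsSwitch G p N y ℓ z)
    (h' : IsSwitch G p N y ℓ z') (hℓ : 2 ≤ ℓ) (hp : ∀ v, p (p v) = v)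
    (hE : switchEdges p ℓ z = switchEdges p ℓ z') : ∀ i ≤ ℓ, z i = z' i := by
  intro i hi
  induction i with
  | zero => rw [h.start, h'.start]
  | succ i ih =>
    have hi' : i < ℓ := hi
    specialize ih hi'.le
    have hmem : s(z i, p (z (i + 1))) ∈ switchEdges p ℓ z' := by
      rw [← hE, mem_switchEdges]
      exact Or.inr ⟨i, hi', rfl⟩
    rcases mem_switchEdges.1 hmem with ⟨j, hj, he⟩ | ⟨j, hj, he⟩
    · exfalso
      have h1 : p (z i) = p (z (i + 1)) := by
        rcases Sym2.eq_iff.1 he with ⟨h2, h3⟩ | ⟨h2, h3⟩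
        · rw [← h2, h3]
        · rw [← h3, hp, h2]
      have := h.inj_succ hi' hi' (Function.LeftInverse.injective hp h1)
      omega
    · rcases Sym2.eq_iff.1 he with ⟨h2, h3⟩ | ⟨-, h3⟩
      · rw [ih] at h2
        have hji := h'.inj _ hj _ hi' h2
        rw [hji] at h3
        exact (Function.LeftInverse.injective hp h3).symm
      · rw [ih] at h3
        exact absurd h3.symm (h'.ne_succ hi' hj)

end IsSwitch

/-- Conversely, every perfect matching differing from `M` in an alternating cycle of length
`2 * ℓ` arises from a closed walk through any prescribed edge of `M` on the cycle. -/
theorem exists_eq_symmDiff_switchEdges [DecidableEq V] {G : SimpleGraph V} {p : V → V}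
    {M M' : Finset (Sym2 V)}
    {y : V} {ℓ : ℕ} (hℓ : 2 ≤ ℓ) (hp : ∀ v, p (p v) = v) (hM : ∀ u w, s(u, w) ∈ M ↔ p u = w)
    (hM' : IsPM G M') (hC : IsCycleEdgeSet (symmDiff M M') (2 * ℓ)) (hy : s(y, p y) ∉ M') :
    ∃ z : ℕ → V, z 0 = y ∧ (∀ i < ℓ, G.Adj (z i) (p (z (i + 1)))) ∧ (∀ i, ℓ ≤ i → z i = y) ∧
      M' = symmDiff M (switchEdges p ℓ z) := by
  obtain ⟨p', hp', hadj', hM'⟩ := hM'.exists_partner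
  have hyE : s(p y, y) ∈ symmDiff M M' := by
    rw [Sym2.eq_swap, Finset.mem_symmDiff]
    exact Or.inl ⟨(hM _ _).2 rfl, hy⟩
  obtain ⟨g, h0, hlast, hm, hinj, hE⟩ := hC.exists_traversal (by omega) hyE
  have hxor : ∀ t < 2 * ℓ, p (g t) ≠ g (t + 1) → p' (g t) = g (t + 1) := by
    intro t ht hne
    have : s(g t, g (t + 1)) ∈ symmDiff M M' := by
      rw [hE]
      exact mem_image_of_mem _ (mem_range.2 ht)
    rw [Finset.mem_symmDiff, hM, hM'] at this
    tauto
  have hxor' : ∀ t < 2 * ℓ, p' (g t) ≠ g (t + 1) → p (g t) = g (t + 1) := by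
    intro t ht hne
    by_contra h
    exact hne (hxor t ht h)
  have hne2 : ∀ t, t + 1 < 2 * ℓ → g t ≠ g (t + 2) := by
    intro t ht h
    rcases Nat.lt_or_ge (t + 2) (2 * ℓ) with h1 | h1
    · have := hinj _ (by omega) _ h1 h
      omega
    · rw [show t + 2 = 2 * ℓ by omega, hm, ← h0] at h
      have := hinj _ (by omega) _ (by omega) h
      omega
  have halt : ∀ t < 2 * ℓ, (t % 2 = 0 → p' (g t) = g (t + 1)) ∧
      (t % 2 = 1 → p (g t) = g (t + 1)) := by
    intro t
    induction t with
    | zero =>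
      refine fun ht => ⟨fun _ => hxor 0 ht ?_, by omega⟩
      rw [h0, ← hlast]
      intro h
      have := hinj _ (by omega) _ (by omega) h
      omega
    | succ t ih =>
      intro ht
      have ih := ih (by omega)
      refine ⟨fun h1 => hxor _ ht ?_, fun h1 => hxor' _ ht ?_⟩
      · rw [← ih.2 (by omega), hp]
        exact hne2 t ht
      · rw [← ih.1 (by omega), hp']
        exact hne2 t ht
  have hz : ∀ i ≤ ℓ, (if i < ℓ then g (2 * i) else y) = g (2 * i) := by
    intro i hi
    split_ifs with h
    · rfl
    · rw [show i = ℓ by omega, hm]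
  have hpz : ∀ i < ℓ, p (g (2 * (i + 1))) = g (2 * i + 1) := by
    intro i hi
    rw [show 2 * (i + 1) = 2 * i + 1 + 1 by ring, ← (halt (2 * i + 1) (by omega)).2 (by omega), hp]
  refine ⟨fun i => if i < ℓ then g (2 * i) else y, ?_, fun i hi => ?_, fun i hi => ?_, ?_⟩
  · simp only [show 0 < ℓ by omega, if_true]
    exact h0
  · simp only [hz i (by omega), hz (i + 1) hi, hpz i hi]
    rw [← (halt (2 * i) (by omega)).1 (by omega)]
    exact hadj' _
  · simp [hi]
  · have : switchEdges p ℓ (fun i => if i < ℓ then g (2 * i) else y) = symmDiff M M' := by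
      rw [hE]
      ext e
      simp only [mem_switchEdges, mem_image, mem_range]
      constructor
      · rintro (⟨i, hi, rfl⟩ | ⟨i, hi, rfl⟩)
        · refine ⟨2 * i + 1, by omega, ?_⟩
          rw [hz (i + 1) hi, hpz i hi, Sym2.eq_swap]
          rfl
        · refine ⟨2 * i, by omega, ?_⟩
          rw [hz (i + 1) hi, hpz i hi, hz i hi.le]
      · rintro ⟨t, ht, rfl⟩
        rcases Nat.even_or_odd' t with ⟨i, rfl | rfl⟩
        · refine Or.inr ⟨i, by omega, ?_⟩
          rw [hz (i + 1) (by omega), hpz i (by omega), hz i (by omega)]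
        · refine Or.inl ⟨i, by omega, ?_⟩
          rw [hz (i + 1) (by omega), hpz i (by omega), Sym2.eq_swap]
          rfl
    rw [this, symmDiff_symmDiff_cancel_left]

end Switch

/-! ### Counting switches -/

section Counting

variable {V : Type*} [Fintype V] [DecidableEq V]

theorem IsMatchingIn.card_filter_le_one {G : SimpleGraph V} {N : Finset (Sym2 V)}
    (hN : IsMatchingIn G N) {f : V → V} (hf : Function.Injective f) (a : V) :
    #{v | s(a, f v) ∈ N} ≤ 1 := by
  refine card_le_one.2 fun v hv w hw => ?_
  simp only [mem_filter, mem_univ, true_and] at hv hw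
  by_contra hne
  exact hN.2 _ hv _ hw (fun h => hne (hf (Sym2.congr_right.1 h))) a (Sym2.mem_mk_left _ _)
    (Sym2.mem_mk_left _ _)

theorem card_filter_partner_mem_le {p : V → V} {M N : Finset (Sym2 V)}
    (hM : ∀ u w, s(u, w) ∈ M ↔ p u = w) : #{v | s(v, p v) ∈ N} ≤ 2 * #(M ∩ N) := by
  have hsub : ({v | s(v, p v) ∈ N} : Finset V) ⊆ (M ∩ N).biUnion Sym2.toFinset := by
    intro v hv
    simp only [mem_filter, mem_univ, true_and] at hv
    exact mem_biUnion.2 ⟨s(v, p v), mem_inter.2 ⟨(hM _ _).2 rfl, hv⟩, by simp⟩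
  refine (card_le_card hsub).trans ((card_biUnion_le_card_mul _ _ 2 fun e _ => ?_).trans_eq
    (mul_comm _ _))
  rw [Sym2.card_toFinset]
  split_ifs <;> simp

/-- The vertices which may not follow the initial segment `z 0, …, z j` in the walk of a switch. -/
def forbidden (p : V → V) (N : Finset (Sym2 V)) (y : V) (j : ℕ) (z : ℕ → V) : Finset V :=
  (((range (j + 1)).image z ∪ (range (j + 1)).image fun i => p (z i)) ∪
    ({v | s(v, p v) ∈ N} : Finset V)) ∪
      (({v | s(z j, p v) ∈ N} : Finset V) ∪ ({v | s(p y, v) ∈ N} : Finset V))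

theorem card_forbidden_le {G : SimpleGraph V} {p : V → V} {M N : Finset (Sym2 V)}
    (hp : ∀ v, p (p v) = v) (hM : ∀ u w, s(u, w) ∈ M ↔ p u = w) (hN : IsMatchingIn G N) (y : V)
    (j : ℕ) (z : ℕ → V) : #(forbidden p N y j z) ≤ 2 * (j + 1) + 2 * #(M ∩ N) + 2 := by
  have h1 : #((range (j + 1)).image z) ≤ j + 1 := card_image_le.trans (by simp)
  have h2 : #((range (j + 1)).image fun i => p (z i)) ≤ j + 1 := card_image_le.trans (by simp)
  have h3 := card_filter_partner_mem_le (N := N) hM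
  have h4 := hN.card_filter_le_one (Function.LeftInverse.injective hp) (z j)
  have h5 := hN.card_filter_le_one Function.injective_id (p y)
  simp only [id] at h5
  unfold forbidden
  grind [card_union_le]

theorem forbidden_congr (p : V → V) (N : Finset (Sym2 V)) (y : V) (j : ℕ) (z z' : ℕ → V)
    (h : ∀ i ≤ j, z i = z' i) : forbidden p N y j z = forbidden p N y j z' := by
  have h1 : (range (j + 1)).image z = (range (j + 1)).image z' :=
    image_congr fun i hi => h i (by simpa [Nat.lt_succ_iff] using hi)
  have h2 : ((range (j + 1)).image fun i => p (z i)) = (range (j + 1)).image fun i => p (z' i) :=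
    image_congr fun i hi => congrArg p (h i (by simpa [Nat.lt_succ_iff] using hi))
  rw [forbidden, forbidden, h1, h2, h j le_rfl]

theorem isSwitch_of_notMem_forbidden {G : SimpleGraph V} {p : V → V} {N : Finset (Sym2 V)} {y : V}
    {L : ℕ} {z : ℕ → V} (hL : 1 ≤ L) (hp : ∀ v, p (p v) = v) (hadj : ∀ v, G.Adj v (p v))
    (hy : s(y, p y) ∈ N) (hz : z ∈ walks (fun u v => G.Adj u (p v)) y (L + 1))
    (hclosed : z (L + 1) = y) (hgood : ∀ j < L, z (j + 1) ∉ forbidden p N y j z) :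
    IsSwitch G p N y (L + 1) z := by
  obtain ⟨h0, hstep, -⟩ := mem_walks.1 hz
  simp only [forbidden, mem_union, mem_image, mem_range, mem_filter, mem_univ, true_and,
    not_or, not_exists, not_and] at hgood
  have hinj : ∀ i j, i < j → j < L + 1 → z i ≠ z j := by
    intro i j hij hj
    obtain ⟨j, rfl⟩ : ∃ j', j = j' + 1 := ⟨j - 1, by omega⟩
    exact (hgood j (by omega)).1.1.1 i hij
  have hne : ∀ i j, i < j → j < L + 1 → p (z i) ≠ z j := by
    intro i j hij hj
    obtain ⟨j, rfl⟩ : ∃ j', j = j' + 1 := ⟨j - 1, by omega⟩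
    exact (hgood j (by omega)).1.1.2 i hij
  refine ⟨h0, hclosed, hstep, fun i hi j hj h => ?_, fun i hi j hj h => ?_, hy,
    fun i hi hiL => ?_, fun i hi => ?_⟩
  · rcases lt_trichotomy i j with h1 | h1 | h1
    · exact absurd h (hinj i j h1 hj)
    · exact h1
    · exact absurd h.symm (hinj j i h1 hi)
  · rcases lt_trichotomy i j with h1 | rfl | h1
    · exact hne i j h1 hj (by rw [h, hp])
    · exact (hadj _).ne h
    · exact hne j i h1 hi h.symm
  · obtain ⟨i, rfl⟩ : ∃ i', i = i' + 1 := ⟨i - 1, by omega⟩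
    exact (hgood i (by omega)).1.2
  · rcases Nat.lt_or_ge i L with h1 | h1
    · exact (hgood i h1).2.1
    · obtain rfl : i = L := by omega
      obtain ⟨i, rfl⟩ : ∃ i', i = i' + 1 := ⟨i - 1, by omega⟩
      rw [hclosed, Sym2.eq_swap]
      exact (hgood i (by omega)).2.2

open Classical in
/-- Closed walks with `ℓ` steps from `y`, alternating between edges of `G` and steps along `p`. -/
noncomputable def closedWalks (G : SimpleGraph V) (p : V → V) (y : V) (ℓ : ℕ) : Finset (ℕ → V) :=
  {z ∈ walks (fun u v => G.Adj u (p v)) y ℓ | z ℓ = y}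

open Classical in
/-- The closed walks from `y` which describe switches. -/
noncomputable def switchWalks (G : SimpleGraph V) (p : V → V) (N : Finset (Sym2 V)) (y : V)
    (L : ℕ) : Finset (ℕ → V) :=
  {z ∈ closedWalks G p y (L + 1) | ∀ j < L, z (j + 1) ∉ forbidden p N y j z}

theorem card_closedWalks_le {G : SimpleGraph V} {p : V → V} {M N : Finset (Sym2 V)} {d L : ℕ}
    (hp : ∀ v, p (p v) = v) (hM : ∀ u w, s(u, w) ∈ M ↔ p u = w) (hN : IsMatchingIn G N)
    (hd : ∀ v, Nat.card {u : V | G.Adj v u} = d) (y : V) :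
    #(closedWalks G p y (L + 1)) ≤ #(switchWalks G p N y L) +
      L * (2 * L + 2 * #(M ∩ N) + 2) * d ^ (L - 1) := by
  classical
  have hbad := card_forbidden_walks_le (R := fun u v => G.Adj u (p v)) (d := d)
    (K := 2 * L + 2 * #(M ∩ N) + 2)
    (fun u => by rw [card_filter_adj_involution G hp u, hd]) y
    (forbidden p N y) (forbidden_congr p N y) L fun j hj z =>
      (card_forbidden_le hp hM hN y j z).trans (by omega)
  refine le_trans ?_ (Nat.add_le_add_left hbad _)
  refine (card_le_card fun z hz => ?_).trans (card_union_le _ _)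
  rw [mem_union]
  by_cases h : ∀ j < L, z (j + 1) ∉ forbidden p N y j z
  · exact Or.inl (mem_filter.2 ⟨hz, h⟩)
  · right
    push Not at h
    rw [closedWalks, mem_filter, mem_walks] at hz
    obtain ⟨⟨h0, h1, h2⟩, h3⟩ := hz
    refine mem_filter.2 ⟨mem_walks.2 ⟨h0, fun i hi => h1 i (by omega), fun i hi => ?_⟩, h⟩
    rcases eq_or_ne i (L + 1) with rfl | hne
    · exact h3
    · exact h2 i (by omega)

/-- The perfect matchings obtained from `M` by switching along an alternating cycle of length
`2 * ℓ` which contains exactly one edge of `N`, this edge being in `M`. -/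
def switchClass (G : SimpleGraph V) (M N : Finset (Sym2 V)) (k ℓ : ℕ) : Set (Finset (Sym2 V)) :=
  {M' | IsPM G M' ∧ (M' ∩ N).card = k - 1 ∧
    IsCycleEdgeSet (symmDiff M M') (2 * ℓ) ∧ ((symmDiff M M') ∩ N).card = 1}

variable {G : SimpleGraph V} {p : V → V} {M N : Finset (Sym2 V)} {k L : ℕ}

theorem card_switchClass_le (hL : 1 ≤ L) (hk : 1 ≤ k) (hp : ∀ v, p (p v) = v)
    (hM : ∀ u w, s(u, w) ∈ M ↔ p u = w) (hMN : #(M ∩ N) = k) {rep : Sym2 V → V}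
    (hrep : ∀ e, rep e ∈ e) :
    Nat.card (switchClass G M N k (L + 1)) ≤
      ∑ e ∈ M ∩ N, #(closedWalks G p (rep e) (L + 1)) := by
  classical
  have hsub : switchClass G M N k (L + 1) ⊆
      ((M ∩ N).biUnion fun e => (closedWalks G p (rep e) (L + 1)).image fun z =>
        symmDiff M (switchEdges p (L + 1) z) : Finset _) := by
    rintro M' ⟨hPM, hcard, hC, -⟩
    obtain ⟨e, he, he'⟩ : ∃ e ∈ M ∩ N, e ∉ M' ∩ N := by
      by_contra! h
      have := card_le_card h
      omega
    have heM := mem_inter.1 he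
    have hee := eq_mk_partner hM heM.1 (hrep e)
    have hyM : s(rep e, p (rep e)) ∉ M' := fun h => by
      rw [← hee] at h
      exact he' (mem_inter.2 ⟨h, heM.2⟩)
    obtain ⟨z, h0, h1, h2, h3⟩ :=
      exists_eq_symmDiff_switchEdges (by omega) hp hM hPM hC hyM
    exact mem_coe.2 (mem_biUnion.2 ⟨e, he, mem_image.2 ⟨z, mem_filter.2
      ⟨mem_walks.2 ⟨h0, h1, fun i hi => h2 i hi.le⟩, h2 _ le_rfl⟩, h3.symm⟩⟩)
  calc Nat.card (switchClass G M N k (L + 1)) ≤ _ := Nat.card_mono (finite_toSet _) hsub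
    _ = _ := Nat.card_eq_finsetCard _
    _ ≤ ∑ e ∈ M ∩ N, _ := card_biUnion_le
    _ ≤ _ := sum_le_sum fun e _ => card_image_le

theorem sum_card_switchWalks_le (hL : 1 ≤ L) (hp : ∀ v, p (p v) = v)
    (hadj : ∀ v, G.Adj v (p v)) (hM : ∀ u w, s(u, w) ∈ M ↔ p u = w) (hMN : #(M ∩ N) = k)
    {rep : Sym2 V → V} (hrep : ∀ e, rep e ∈ e) :
    ∑ e ∈ M ∩ N, #(switchWalks G p N (rep e) L) ≤ Nat.card (switchClass G M N k (L + 1)) := by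
  classical
  have hℓ : 2 ≤ L + 1 := by omega
  have hsw : ∀ e ∈ M ∩ N, ∀ z ∈ switchWalks G p N (rep e) L,
      IsSwitch G p N (rep e) (L + 1) z := by
    intro e he z hz
    have he' := mem_inter.1 he
    obtain ⟨hz, hgood⟩ := mem_filter.1 hz
    obtain ⟨hz, hclosed⟩ := mem_filter.1 hz
    exact isSwitch_of_notMem_forbidden hL hp hadj
      (eq_mk_partner hM he'.1 (hrep e) ▸ he'.2) hz hclosed hgood
  rw [← card_sigma, ← Nat.card_eq_finsetCard]
  refine Nat.card_le_card_of_injective (fun x => ⟨symmDiff M (switchEdges p (L + 1) x.1.2), ?_⟩) ?_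
  · obtain ⟨⟨e, z⟩, hx⟩ := x
    obtain ⟨he, hz⟩ := mem_sigma.1 hx
    have h := hsw e he z hz
    refine ⟨h.isPM hℓ hp hadj hM, ?_, ?_, ?_⟩
    · rw [h.symmDiff_inter hℓ hM, card_erase_of_mem, hMN]
      exact mem_inter.2 ⟨(hM _ _).2 rfl, h.mem⟩
    · rw [symmDiff_symmDiff_cancel_left]
      exact h.isCycleEdgeSet hℓ hp
    · rw [symmDiff_symmDiff_cancel_left, h.inter_eq hℓ, card_singleton]
  · rintro ⟨⟨e, z⟩, hx⟩ ⟨⟨e', z'⟩, hx'⟩ heq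
    obtain ⟨he, hz⟩ := mem_sigma.1 hx
    obtain ⟨he', hz'⟩ := mem_sigma.1 hx'
    dsimp only at he he' hz hz'
    have hE : switchEdges p (L + 1) z = switchEdges p (L + 1) z' :=
      symmDiff_right_injective M (congrArg Subtype.val heq)
    have h := hsw e he z hz
    have h' := hsw e' he' z' hz'
    have hee : e = e' := by
      have h1 := h.inter_eq hℓ
      rw [hE, h'.inter_eq hℓ, singleton_inj] at h1
      rw [eq_mk_partner hM (mem_inter.1 he).1 (hrep e),
        eq_mk_partner hM (mem_inter.1 he').1 (hrep e'), h1]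
    subst hee
    have hzz : z = z' := by
      have h1 := h.ext_of_switchEdges_eq h' hℓ hp hE
      have h2 := (mem_walks.1 (mem_filter.1 (mem_filter.1 hz).1).1).2.2
      have h3 := (mem_walks.1 (mem_filter.1 (mem_filter.1 hz').1).1).2.2
      ext i
      rcases Nat.lt_or_ge (L + 1) i with hi | hi
      · rw [h2 i hi, h3 i hi]
      · exact h1 i hi
    subst hzz
    rfl

end Counting

/-! ### Estimates -/

section Estimates

theorem abs_card_closedWalks_sub_le {V : Type*} [Fintype V] [DecidableEq V] [Nonempty V]
    {G : SimpleGraph V} {p : V → V} (hp : ∀ v, p (p v) = v) {δ τ ν : ℝ} (hδ : 0 < δ)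
    (hdeg : ∀ v, (Nat.card {u : V | G.Adj v u} : ℝ) = δ * Fintype.card V)
    (hG : RobustExpander G ν τ) (hν : 0 < ν) (hντ : ν ≤ τ) (hτδ : 2 * τ ≤ δ) (y : V) (ℓ : ℕ) :
    |(#(closedWalks G p y ℓ) : ℝ) - (δ * Fintype.card V) ^ ℓ / Fintype.card V| ≤
      (δ * Fintype.card V) ^ ℓ * Real.exp
        (-(ν ^ (⌈1 / ν⌉₊ + 1) / δ ^ (⌈1 / ν⌉₊ + 2)) * (ℓ / (⌈1 / ν⌉₊ + 2) : ℕ)) := by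
  set J := ⌈1 / ν⌉₊
  set c := ν ^ (J + 1) / δ ^ (J + 2) with hc
  have hn : (0 : ℝ) < Fintype.card V := by exact_mod_cast Fintype.card_pos
  have hrow := sum_stepMatrix_row (p := p) hp hdeg
  have hcol := sum_stepMatrix_col (p := p) hdeg
  have hs : ∀ u v, (ν * Fintype.card V) ^ (J + 1) ≤ (stepMatrix G p ^ (J + 2)) u v :=
    le_stepMatrix_pow hp hdeg hG hν hντ hτδ
  have key := abs_pow_apply_sub_le (stepMatrix_nonneg G p) hrow hcol hs
    (ℓ / (J + 2)) (ℓ % (J + 2)) y y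
  have hD : (δ * Fintype.card V) ^ (J + 2) - (ν * Fintype.card V) ^ (J + 1) * Fintype.card V =
      (δ * Fintype.card V) ^ (J + 2) * (1 - c) := by
    rw [hc]
    field_simp
    ring
  have hc1 : 0 ≤ 1 - c := by
    have h1 : (Fintype.card V : ℝ) * (ν * Fintype.card V) ^ (J + 1) ≤
        (δ * Fintype.card V) ^ (J + 2) := by
      rw [← sum_row_pow hrow (J + 2) y, ← nsmul_eq_mul]
      exact card_nsmul_le_sum _ _ _ fun w _ => hs y w
    refine nonneg_of_mul_nonneg_right (b := 1 - c) (a := (δ * Fintype.card V) ^ (J + 2)) ?_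
      (by positivity)
    rw [← hD]
    linarith
  rw [closedWalks, card_walks_to, ← stepMatrix]
  rw [Nat.div_add_mod, hD, mul_pow (_ ^ (J + 2)), mul_right_comm, ← pow_mul, ← pow_add,
    Nat.div_add_mod] at key
  refine key.trans ?_
  gcongr
  calc (1 - c) ^ (ℓ / (J + 2)) ≤ Real.exp (-c) ^ (ℓ / (J + 2)) := by
        gcongr
        linarith [Real.add_one_le_exp (-c)]
    _ = _ := by rw [← Real.exp_nat_mul, mul_comm]

open Filter Topology in
theorem eventually_estimates {δ c : ℝ} (hδ : 0 < δ) (hc : 0 < c) {m : ℕ} (hm : 0 < m) :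
    ∀ᶠ n : ℕ in atTop, 1 ≤ n ∧ 1 ≤ ⌈(Real.log n) ^ 2⌉₊ ∧
      n * Real.exp (-c * ((⌈(Real.log n) ^ 2⌉₊ + 1) / m : ℕ)) ≤ (n : ℝ) ^ (-(1 / 6) : ℝ) ∧
      (⌈(Real.log n) ^ 2⌉₊ : ℝ) * (2 * ⌈(Real.log n) ^ 2⌉₊ + 2 * (n : ℝ) ^ ((1 : ℝ) / 3) + 2) ≤
        δ ^ 2 * n * (n : ℝ) ^ (-(1 / 6) : ℝ) := by
  have hlog : Tendsto (fun n : ℕ => Real.log n) atTop atTop :=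
    Real.tendsto_log_atTop.comp tendsto_natCast_atTop_atTop
  have hpow : Tendsto (fun n : ℕ => (n : ℝ) ^ (1 / 6 : ℝ)) atTop atTop :=
    (tendsto_rpow_atTop (by norm_num)).comp tendsto_natCast_atTop_atTop
  have hsmall : ∀ᶠ n : ℕ in atTop, (Real.log n) ^ 2 ≤ 1 / 2 * (n : ℝ) ^ (1 / 6 : ℝ) := by
    have h := ((isLittleO_log_rpow_rpow_atTop (s := 1 / 6) 2 (by norm_num)).bound
      (show (0 : ℝ) < 1 / 2 by norm_num))
    filter_upwards [tendsto_natCast_atTop_atTop.eventually h] with n hn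
    rw [Real.rpow_two, Real.norm_of_nonneg (sq_nonneg _),
      Real.norm_of_nonneg (by positivity)] at hn
    exact hn
  filter_upwards [eventually_ge_atTop 1, hlog.eventually_ge_atTop 1,
    hlog.eventually_ge_atTop c, hlog.eventually_ge_atTop (3 * m / c), hsmall,
    hpow.eventually_ge_atTop 4, hpow.eventually_ge_atTop (6 / δ ^ 2)] with n h1 h2 h3 h4 h5 h6 h7
  have hn : (0 : ℝ) < n := by exact_mod_cast h1
  have hm' : (0 : ℝ) < m := by exact_mod_cast hm
  set x := Real.log n with hx
  set L := ⌈x ^ 2⌉₊ with hL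
  refine ⟨h1, Nat.one_le_ceil_iff.2 (by positivity), ?_, ?_⟩
  · have hxL : x ^ 2 ≤ L := Nat.le_ceil _
    have hq : ((L : ℝ) + 1) / m - 1 ≤ ((L + 1) / m : ℕ) := by
      have hdiv : L + 1 < m * ((L + 1) / m + 1) := Nat.lt_mul_div_succ _ hm
      have hdiv' : (L : ℝ) + 1 < m * (((L + 1) / m : ℕ) + 1) := by exact_mod_cast hdiv
      rw [sub_le_iff_le_add, div_le_iff₀' hm']
      exact hdiv'.le
    have h8 : 3 * x ≤ c * (((L : ℝ) + 1) / m) := by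
      rw [div_le_iff₀ hc] at h4
      rw [← mul_div_assoc, le_div_iff₀ hm']
      nlinarith
    have h9 : c * (((L : ℝ) + 1) / m - 1) ≤ c * ((L + 1) / m : ℕ) := by gcongr
    rw [Real.rpow_def_of_pos hn, ← hx]
    calc n * Real.exp (-c * ((L + 1) / m : ℕ))
        = Real.exp (x + -c * ((L + 1) / m : ℕ)) := by rw [Real.exp_add, hx, Real.exp_log hn]
      _ ≤ _ := by
        gcongr
        linarith
  · set t := (n : ℝ) ^ (1 / 6 : ℝ) with ht
    have ht0 : 0 < t := by positivity
    have hLt : (L : ℝ) ≤ t := by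
      have := Nat.ceil_lt_add_one (sq_nonneg x)
      linarith
    have h13 : (n : ℝ) ^ ((1 : ℝ) / 3) = t ^ 2 := by
      rw [ht, ← Real.rpow_natCast, ← Real.rpow_mul hn.le]; norm_num
    have hn6 : (n : ℝ) = t ^ 6 := by
      rw [ht, ← Real.rpow_natCast, ← Real.rpow_mul hn.le]; norm_num
    have hinv : (n : ℝ) ^ (-(1 / 6) : ℝ) = t⁻¹ := by rw [Real.rpow_neg hn.le]
    have h8 : 6 ≤ δ ^ 2 * t := by
      rwa [div_le_iff₀' (by positivity)] at h7
    rw [h13, hinv, hn6]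
    have h9 : δ ^ 2 * t ^ 6 * t⁻¹ = δ ^ 2 * t * t ^ 4 := by field_simp
    rw [h9]
    calc (L : ℝ) * (2 * L + 2 * t ^ 2 + 2) ≤ t * (2 * t + 2 * t ^ 2 + 2) := by gcongr
      _ ≤ 6 * t ^ 4 := by
        nlinarith [pow_pos ht0 2, pow_pos ht0 3, pow_le_pow_left₀ (by norm_num) h6 2]
      _ ≤ _ := by gcongr

theorem switchClass_bounds {V : Type*} [Fintype V] [DecidableEq V] [Nonempty V]
    {G : SimpleGraph V} {M N : Finset (Sym2 V)} {k L n : ℕ} {δ τ ν x : ℝ} (hδ : 0 < δ)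
    (hn : Fintype.card V = n) (hdeg : ∀ v, (Nat.card {u : V | G.Adj v u} : ℝ) = δ * n)
    (hG : RobustExpander G ν τ) (hν : 0 < ν) (hντ : ν ≤ τ) (hτδ : 2 * τ ≤ δ)
    (hN : IsMatchingIn G N) (hM : IsPM G M) (hk : 1 ≤ k) (hMN : #(M ∩ N) = k) (hL : 1 ≤ L)
    (hmix : n * Real.exp (-(ν ^ (⌈1 / ν⌉₊ + 1) / δ ^ (⌈1 / ν⌉₊ + 2)) *
      ((L + 1) / (⌈1 / ν⌉₊ + 2) : ℕ)) ≤ x)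
    (hbad : (L : ℝ) * (2 * L + 2 * k + 2) ≤ δ ^ 2 * n * x) :
    (1 - 2 * x) * k * δ ^ (L + 1) * n ^ L ≤ Nat.card (switchClass G M N k (L + 1)) ∧
      Nat.card (switchClass G M N k (L + 1)) ≤ (1 + x) * k * δ ^ (L + 1) * n ^ L := by
  subst hn
  set n : ℝ := (Fintype.card V : ℝ) with hn
  have hn0 : 0 < n := by
    rw [hn]
    exact_mod_cast Fintype.card_pos
  obtain ⟨p, hp, hadj, hpM⟩ := hM.exists_partner
  let rep : Sym2 V → V := fun e => (Quot.out e).1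
  have hrep : ∀ e, rep e ∈ e := fun e => Sym2.out_fst_mem e
  set T : ℝ := δ ^ (L + 1) * n ^ L with hT
  have hTd : (δ * n) ^ (L + 1) = T * n := by rw [hT, mul_pow]; ring
  have hT0 : 0 < T := by positivity
  have hclosed : ∀ y, |(#(closedWalks G p y (L + 1)) : ℝ) - T| ≤ T * x := by
    intro y
    have h := abs_card_closedWalks_sub_le hp hδ hdeg hG hν hντ hτδ y (L + 1)
    rw [← hn, hTd, mul_div_cancel_right₀ _ hn0.ne'] at h
    refine h.trans ?_
    rw [mul_assoc]
    gcongr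
  obtain ⟨d, hd⟩ : ∃ d : ℕ, ∀ v, Nat.card {u : V | G.Adj v u} = d := by
    refine ⟨Nat.card {u : V | G.Adj (Classical.arbitrary V) u}, fun v => ?_⟩
    exact_mod_cast (hdeg v).trans (hdeg _).symm
  have hdn : (d : ℝ) = δ * n := by rw [← hdeg (Classical.arbitrary V), hd]
  have hbad' : ((L * (2 * L + 2 * k + 2) * d ^ (L - 1) : ℕ) : ℝ) ≤ T * x := by
    push_cast
    rw [hdn]
    calc (L : ℝ) * (2 * L + 2 * k + 2) * (δ * n) ^ (L - 1)
        ≤ δ ^ 2 * n * x * (δ * n) ^ (L - 1) := by gcongr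
      _ = T * x := by
        obtain ⟨L, rfl⟩ : ∃ L', L = L' + 1 := ⟨L - 1, by omega⟩
        rw [hT, Nat.add_sub_cancel, mul_pow]
        ring
  have hup := card_switchClass_le (G := G) (N := N) hL hk hp hpM hMN hrep
  have hlow := sum_card_switchWalks_le hL hp hadj hpM hMN hrep
  constructor
  · have h1 : ∀ e ∈ M ∩ N, T - 2 * (T * x) ≤ (#(switchWalks G p N (rep e) L) : ℝ) := by
      intro e _
      have h2 := card_closedWalks_le (L := L) hp hpM hN hd (rep e)
      rw [hMN] at h2
      have h2' : (#(closedWalks G p (rep e) (L + 1)) : ℝ) ≤ #(switchWalks G p N (rep e) L) +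
          ((L * (2 * L + 2 * k + 2) * d ^ (L - 1) : ℕ) : ℝ) := by exact_mod_cast h2
      have h3 := abs_le.1 (hclosed (rep e))
      linarith [h3.1]
    have h2 := card_nsmul_le_sum _ _ _ h1
    rw [hMN, nsmul_eq_mul] at h2
    calc _ = k * (T - 2 * (T * x)) := by rw [hT]; ring
      _ ≤ _ := h2
      _ ≤ _ := by exact_mod_cast hlow
  · have h1 : ∀ e ∈ M ∩ N, (#(closedWalks G p (rep e) (L + 1)) : ℝ) ≤ T + T * x := by
      intro e _
      have h3 := abs_le.1 (hclosed (rep e))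
      linarith [h3.2]
    have h2 := sum_le_card_nsmul _ _ _ h1
    rw [hMN, nsmul_eq_mul] at h2
    calc (Nat.card (switchClass G M N k (L + 1)) : ℝ) ≤ _ := by exact_mod_cast hup
      _ ≤ _ := h2
      _ = _ := by rw [hT]; ring

end Estimates

/-- switching degrees, upper class. -/
theorem switching_degree_upper_class :
    ∀ δ : ℝ, 0 < δ → δ ≤ 1 →
    ∃ τ₀ : ℝ, 0 < τ₀ ∧
    ∀ τ ν : ℝ, 0 < ν → ν ≤ τ → τ ≤ τ₀ →
    ∃ n₀ : ℕ, ∀ n : ℕ, n₀ ≤ n → Even n →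
    ∀ ℓ : ℕ, ℓ = ⌈(Real.log n) ^ 2⌉₊ + 1 →
    ∀ (V : Type) [Fintype V] [DecidableEq V], Fintype.card V = n →
    ∀ G : SimpleGraph V,
      (∀ v : V, (Nat.card {u : V | G.Adj v u} : ℝ) = δ * (n : ℝ)) →
      RobustExpander G ν τ →
    ∀ N : Finset (Sym2 V), IsMatchingIn G N →
    ∀ k : ℕ, 1 ≤ k →
      (k : ℝ) ≤ min (N.card : ℝ) ((n : ℝ) ^ ((1 : ℝ) / 3)) →
    ∀ M : Finset (Sym2 V), IsPM G M → (M ∩ N).card = k →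
      (1 - 3 * (n : ℝ) ^ (-(1 / 6) : ℝ)) * (k : ℝ) * δ ^ ℓ * (n : ℝ) ^ (ℓ - 1) ≤
        (Nat.card {M' : Finset (Sym2 V) // IsPM G M' ∧ (M' ∩ N).card = k - 1 ∧
          IsCycleEdgeSet (symmDiff M M') (2 * ℓ) ∧ ((symmDiff M M') ∩ N).card = 1} : ℝ) ∧
      (Nat.card {M' : Finset (Sym2 V) // IsPM G M' ∧ (M' ∩ N).card = k - 1 ∧
          IsCycleEdgeSet (symmDiff M M') (2 * ℓ) ∧ ((symmDiff M M') ∩ N).card = 1} : ℝ) ≤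
        (1 + 3 * (n : ℝ) ^ (-(1 / 6) : ℝ)) * (k : ℝ) * δ ^ ℓ * (n : ℝ) ^ (ℓ - 1) := by
  intro δ hδ _
  refine ⟨δ / 2, by positivity, fun τ ν hν hντ hτ => ?_⟩
  obtain ⟨n₀, hn₀⟩ := Filter.eventually_atTop.1 (eventually_estimates (m := ⌈1 / ν⌉₊ + 2) hδ
    (show 0 < ν ^ (⌈1 / ν⌉₊ + 1) / δ ^ (⌈1 / ν⌉₊ + 2) by positivity) (by omega))
  refine ⟨n₀, ?_⟩
  rintro n hn - ℓ rfl V _ _ hV G hdeg hG N hN k hk hkn M hM hMN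
  obtain ⟨h1, h2, h3, h4⟩ := hn₀ n hn
  have : Nonempty V := Fintype.card_pos_iff.1 (by omega)
  have hbounds := switchClass_bounds hδ hV hdeg hG hν hντ (by linarith) hN hM hk hMN h2 h3
    (le_trans (by gcongr; exact hkn.trans (min_le_right _ _)) h4)
  have hx : 0 ≤ (n : ℝ) ^ (-(1 / 6) : ℝ) := by positivity
  rw [Nat.add_sub_cancel]
  refine ⟨le_trans ?_ hbounds.1, le_trans hbounds.2 ?_⟩ <;> gcongr <;> linarith

end RPM
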